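/- arXiv:1807.05475 — 7 statements merged into one kernel-verified Lean document; each statement's English description precedes it below -/
import Mathlib

section
/- Let n ≥ 1, let ⪯ be a tree poset on Fin n, and let a ⋖ b be a covering relation of ⪯. Then σ_⪯ ∩ {x ∈ ℝ^n : x_a = x_b} = cone({v_{c→d} : c ⋖ d a covering relation of ⪯ with (c,d) ≠ (a,b)}) + ℝ·e, and moreover this set equals σ_Q = {x ∈ ℝ^n : x_i ≤ x_j whenever i Q j}, where Q is the reflexive-transitive closure of the relation ⪯ together with the single additional pair (b,a). -/
noncomputable section

/-- The 0/1 indicator vector of a subset `S ⊆ Fin n`, as an element of `ℝ^n`. -/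
def indVec {n : ℕ} (S : Set (Fin n)) : Fin n → ℝ := S.indicator fun _ => 1

/-- The all-ones vector `e ∈ ℝ^n`. -/
def allOnes (n : ℕ) : Fin n → ℝ := fun _ => 1

/-- The cone `σ_⪯ = {x ∈ ℝ^n : x_a ≤ x_b whenever a ⪯ b}` of a relation. -/
def sigmaCone {n : ℕ} (r : Fin n → Fin n → Prop) : Set (Fin n → ℝ) :=
  {x | ∀ a b, r a b → x a ≤ x b}

/-- `b` covers `a` in the relation `r`: `a ⋖ b`. -/
def CoversRel {n : ℕ} (r : Fin n → Fin n → Prop) (a b : Fin n) : Prop :=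
  r a b ∧ a ≠ b ∧ ∀ c, r a c → r c b → c = a ∨ c = b

/-- The Hasse diagram of a partial order on `Fin n`, as an undirected simple graph:
an edge `{a, b}` for each covering relation `a ⋖ b`. -/
def hasseGraph {n : ℕ} (r : Fin n → Fin n → Prop) : SimpleGraph (Fin n) where
  Adj a b := CoversRel r a b ∨ CoversRel r b a
  symm := ⟨fun a b h => h.symm⟩
  loopless := ⟨fun a h => by rcases h with h | h <;> exact h.2.1 rfl⟩

/-- `r` is a tree poset: a partial order whose Hasse diagram is a tree. -/
def IsTreePoset {n : ℕ} (r : Fin n → Fin n → Prop) : Prop :=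
  (∀ a, r a a) ∧ (∀ a b c, r a b → r b c → r a c) ∧ (∀ a b, r a b → r b a → a = b) ∧
    (hasseGraph r).IsTree

/-- `B(a,b)`: the vertex set of the connected component of `b` in the Hasse diagram
after deleting the edge `{a, b}`. -/
def compB {n : ℕ} (r : Fin n → Fin n → Prop) (a b : Fin n) : Set (Fin n) :=
  {x | ((hasseGraph r).deleteEdges {s(a, b)}).Reachable b x}

/-- The ray generator `v_{a→b} = e_{B(a,b)}`. -/
def rayVec {n : ℕ} (r : Fin n → Fin n → Prop) (a b : Fin n) : Fin n → ℝ :=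
  indVec (compB r a b)

/-- `cone(V)`: the set of finite nonnegative linear combinations of elements of `V`. -/
def coneOf {n : ℕ} (V : Set (Fin n → ℝ)) : Set (Fin n → ℝ) :=
  {x | ∃ (s : Finset (Fin n → ℝ)) (c : (Fin n → ℝ) → ℝ),
    ↑s ⊆ V ∧ (∀ v ∈ s, 0 ≤ c v) ∧ x = ∑ v ∈ s, c v • v}

/-- `cone(V) + ℝ·e`. -/
def coneAddLine {n : ℕ} (V : Set (Fin n → ℝ)) : Set (Fin n → ℝ) :=
  {x | ∃ y ∈ coneOf V, ∃ μ : ℝ, x = y + μ • allOnes n}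

/-- The comparability graph of a relation: an edge `{i, j}` for each pair `i ≠ j`
with `i ⪯ j` or `j ⪯ i`. -/
def compGraph {n : ℕ} (r : Fin n → Fin n → Prop) : SimpleGraph (Fin n) where
  Adj i j := i ≠ j ∧ (r i j ∨ r j i)
  symm := ⟨fun i j h => ⟨h.1.symm, h.2.symm⟩⟩
  loopless := ⟨fun i h => h.1 rfl⟩

/-- The setoid on `Fin n` induced by a preposet: `i ∼ j` iff `i ⪯ j` and `j ⪯ i`. -/
def preSetoid {n : ℕ} (r : Fin n → Fin n → Prop)
    (hrefl : ∀ a, r a a) (htrans : ∀ a b c, r a b → r b c → r a c) : Setoid (Fin n) where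
  r i j := r i j ∧ r j i
  iseqv := ⟨fun i => ⟨hrefl i, hrefl i⟩, fun h => ⟨h.2, h.1⟩,
    fun h1 h2 => ⟨htrans _ _ _ h1.1 h2.1, htrans _ _ _ h2.2 h1.2⟩⟩

/-- The class of `j` covers the class of `i` in the partial order induced on
`∼`-equivalence classes by the preposet `r`. -/
def CoversCl {n : ℕ} (r : Fin n → Fin n → Prop) (i j : Fin n) : Prop :=
  r i j ∧ ¬ r j i ∧ ∀ c, r i c → r c j → (r c i ∨ r j c)

/-- The Hasse diagram of a preposet, as an undirected simple graph on the set of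
`∼`-equivalence classes: an edge `{C, C'}` for each covering relation `C ⋖ C'`. -/
def hasseGraphQ {n : ℕ} (r : Fin n → Fin n → Prop)
    (hrefl : ∀ a, r a a) (htrans : ∀ a b c, r a b → r b c → r a c) :
    SimpleGraph (Quotient (preSetoid r hrefl htrans)) where
  Adj C D := ∃ i j, Quotient.mk _ i = C ∧ Quotient.mk _ j = D ∧
    (CoversCl r i j ∨ CoversCl r j i)
  symm := by
    constructor
    rintro C D ⟨i, j, hi, hj, h⟩
    exact ⟨j, i, hj, hi, h.symm⟩
  loopless := by
    constructor
    rintro C ⟨i, j, hi, hj, h⟩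
    have hij : r i j ∧ r j i := Quotient.exact (hi.trans hj.symm)
    rcases h with h | h
    · exact h.2.1 hij.2
    · exact h.2.1 hij.1

/-- For a Hasse-diagram edge `[i] → [j]` of a preposet, the union of the equivalence
classes lying in the connected component of `[j]` after deleting the edge `{[i], [j]}`. -/
def compBQ {n : ℕ} (r : Fin n → Fin n → Prop)
    (hrefl : ∀ a, r a a) (htrans : ∀ a b c, r a b → r b c → r a c) (i j : Fin n) :
    Set (Fin n) :=
  {x | ((hasseGraphQ r hrefl htrans).deleteEdges
      {s(Quotient.mk (preSetoid r hrefl htrans) i, Quotient.mk (preSetoid r hrefl htrans) j)}).Reachable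
      (Quotient.mk (preSetoid r hrefl htrans) j) (Quotient.mk (preSetoid r hrefl htrans) x)}

/-- `A_i`: the connected component of `a i` in the Hasse diagram after deleting
all `k` edges `{a i, b}`. -/
def compA {n k : ℕ} (r : Fin n → Fin n → Prop) (a : Fin k → Fin n) (b : Fin n) (i : Fin k) :
    Set (Fin n) :=
  {x | ((hasseGraph r).deleteEdges {e | ∃ j, e = s(a j, b)}).Reachable (a i) x}

/-- The relation `E'` from the proof of the main theorem: all covering pairs `(i,j)` of `r`
with `j ≠ b`, the pair `(a i₀, b)`, and the pairs `(a m, a i₀)` for `m ≠ i₀`. -/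
def newRel {n k : ℕ} (r : Fin n → Fin n → Prop) (a : Fin k → Fin n) (b : Fin n) (i₀ : Fin k) :
    Fin n → Fin n → Prop :=
  fun i j => (CoversRel r i j ∧ j ≠ b) ∨ (i = a i₀ ∧ j = b) ∨
    (∃ m : Fin k, m ≠ i₀ ∧ i = a m ∧ j = a i₀)

end

/-- A function monotone along covering relations is monotone. -/
lemma mem_sigmaCone_of_covers {n : ℕ} {r : Fin n → Fin n → Prop} (h : IsTreePoset r)
    (x : Fin n → ℝ) (hx : ∀ c d, CoversRel r c d → x c ≤ x d) : x ∈ sigmaCone r := by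
  classical
  obtain ⟨h1, h2, h3, -⟩ := h
  let P : PartialOrder (Fin n) :=
    { le := r, lt := fun c d => r c d ∧ ¬ r d c, lt_iff_le_not_ge := fun _ _ => Iff.rfl, le_refl := h1, le_trans := h2, le_antisymm := h3 }
  let L : @LocallyFiniteOrder (Fin n) P.toPreorder :=
    @Fintype.toLocallyFiniteOrder (Fin n) P.toPreorder _ (Classical.decRel _) (Classical.decRel _)
  have key := (@monotone_iff_forall_covBy (Fin n) ℝ P L _ x).2 (by
    intro c d hcd
    have hlt := hcd.1
    apply hx
    have hle : r c d := @le_of_lt (Fin n) P.toPreorder c d hlt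
    have hne : c ≠ d := @ne_of_lt (Fin n) P.toPreorder c d hlt
    refine ⟨hle, hne, ?_⟩
    intro e hce hed
    by_contra hcon
    push Not at hcon
    exact hcd.2 (@lt_of_le_of_ne (Fin n) P c e hce hcon.1.symm)
      (@lt_of_le_of_ne (Fin n) P e d hed hcon.2))
  intro c d hcd
  exact key hcd

lemma rayVec_self_right {n : ℕ} {r : Fin n → Fin n → Prop} (c d : Fin n) :
    rayVec r c d d = 1 := by
  have : d ∈ compB r c d := SimpleGraph.Reachable.refl d
  simp [rayVec, indVec, this]

lemma rayVec_self_left {n : ℕ} {r : Fin n → Fin n → Prop} (h : IsTreePoset r) {c d : Fin n}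
    (hcd : CoversRel r c d) : rayVec r c d c = 0 := by
  have hb := (SimpleGraph.isAcyclic_iff_forall_adj_isBridge.1 h.2.2.2.isAcyclic)
    (show (hasseGraph r).Adj c d from Or.inl hcd)
  rw [SimpleGraph.isBridge_iff] at hb
  have : c ∉ compB r c d := fun hc => hb (SimpleGraph.Reachable.symm hc)
  simp [rayVec, indVec, this]

lemma rayVec_eq_of_ne {n : ℕ} {r : Fin n → Fin n → Prop} (h : IsTreePoset r) {c d p q : Fin n}
    (hcd : CoversRel r c d) (hpq : CoversRel r p q) (hne : (c, d) ≠ (p, q)) :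
    rayVec r c d p = rayVec r c d q := by
  have hadj : ((hasseGraph r).deleteEdges {s(c, d)}).Adj p q := by
    rw [SimpleGraph.deleteEdges_adj]
    refine ⟨Or.inl hpq, ?_⟩
    intro hs
    rw [Set.mem_singleton_iff, Sym2.eq_iff] at hs
    rcases hs with ⟨rfl, rfl⟩ | ⟨rfl, rfl⟩
    · exact hne rfl
    · exact hpq.2.1 (h.2.2.1 _ _ hpq.1 hcd.1)
  have hiff : p ∈ compB r c d ↔ q ∈ compB r c d :=
    ⟨fun hp => SimpleGraph.Reachable.trans hp hadj.reachable,
      fun hq => SimpleGraph.Reachable.trans hq hadj.symm.reachable⟩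
  by_cases hp : p ∈ compB r c d
  · simp [rayVec, indVec, hp, hiff.1 hp]
  · have hq : q ∉ compB r c d := fun hq => hp (hiff.2 hq)
    simp [rayVec, indVec, hp, hq]

/-- A function constant along covering relations is constant. -/
lemma const_of_covers {n : ℕ} {r : Fin n → Fin n → Prop} (h : IsTreePoset r)
    (x : Fin n → ℝ) (hx : ∀ c d, CoversRel r c d → x c = x d) (u v : Fin n) : x u = x v := by
  obtain ⟨w⟩ := h.2.2.2.1.preconnected u v
  induction w with
  | nil => rfl
  | cons hadj _ ih =>
    rw [← ih]
    rcases hadj with hh | hh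
    · exact hx _ _ hh
    · exact (hx _ _ hh).symm

/-- Nonnegative combinations of an indexed family lie in the cone. -/
lemma sum_mem_coneOf {n : ℕ} {ι : Type*} (V : Set (Fin n → ℝ)) (s : Finset ι)
    (f : ι → Fin n → ℝ) (w : ι → ℝ) (hf : ∀ i ∈ s, f i ∈ V) (hw : ∀ i ∈ s, 0 ≤ w i) :
    ∑ i ∈ s, w i • f i ∈ coneOf V := by
  classical
  refine ⟨s.image f, fun v => ∑ i ∈ s with f i = v, w i, ?_, ?_, ?_⟩
  · intro v hv
    obtain ⟨i, hi, rfl⟩ := Finset.mem_image.1 (Finset.mem_coe.1 hv)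
    exact hf i hi
  · intro v _
    exact Finset.sum_nonneg fun i hi => hw i (Finset.mem_filter.1 hi).1
  · rw [← Finset.sum_fiberwise_of_maps_to (fun i hi => Finset.mem_image_of_mem f hi)]
    refine Finset.sum_congr rfl fun v _ => ?_
    rw [Finset.sum_smul]
    refine Finset.sum_congr rfl fun i hi => ?_
    rw [(Finset.mem_filter.1 hi).2]

/-- For a tree poset `⪯` on `Fin n` and a covering relation `a ⋖ b`,
the facet `σ_⪯ ∩ {x : x_a = x_b}` equals
`cone({v_{c→d} : c ⋖ d, (c,d) ≠ (a,b)}) + ℝ·e`, and it also equals `σ_Q` where `Q` is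
the reflexive-transitive closure of `⪯` together with the additional pair `(b,a)`. -/
theorem facet_of_treePoset_cone (n : ℕ) (hn : 1 ≤ n)
    (r : Fin n → Fin n → Prop) (hposet : IsTreePoset r)
    (a b : Fin n) (hab : CoversRel r a b) :
    sigmaCone r ∩ {x | x a = x b} =
      coneAddLine {v | ∃ c d, CoversRel r c d ∧ (c, d) ≠ (a, b) ∧ v = rayVec r c d} ∧
    sigmaCone r ∩ {x | x a = x b} =
      sigmaCone (Relation.ReflTransGen fun i j => r i j ∨ (i = b ∧ j = a)) := by
  classical
  refine ⟨?_, ?_⟩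
  · apply Set.Subset.antisymm
    · rintro x ⟨hx, hxab⟩
      have hxab : x a = x b := hxab
      let s : Finset (Fin n × Fin n) :=
        Finset.univ.filter fun p => CoversRel r p.1 p.2 ∧ p ≠ (a, b)
      have hs : ∀ p, p ∈ s ↔ CoversRel r p.1 p.2 ∧ p ≠ (a, b) := fun p => by simp [s]
      let y : Fin n → ℝ := ∑ p ∈ s, (x p.2 - x p.1) • rayVec r p.1 p.2
      have hyV : y ∈ coneOf {v | ∃ c d, CoversRel r c d ∧ (c, d) ≠ (a, b) ∧ v = rayVec r c d} :=
        sum_mem_coneOf _ s (fun p => rayVec r p.1 p.2) (fun p => x p.2 - x p.1)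
          (fun p hp => ⟨p.1, p.2, ((hs p).1 hp).1, ((hs p).1 hp).2, rfl⟩)
          (fun p hp => sub_nonneg.2 (hx _ _ ((hs p).1 hp).1.1))
      have hyc : ∀ p q, CoversRel r p q → y q - y p = x q - x p := by
        intro p q hpq
        have e1 : y q - y p = ∑ t ∈ s, if t = (p, q) then x q - x p else 0 := by
          simp only [y, Finset.sum_apply, Pi.smul_apply, smul_eq_mul]
          rw [← Finset.sum_sub_distrib]
          refine Finset.sum_congr rfl fun t ht => ?_
          split_ifs with htp
          · subst htp
            simp [rayVec_self_right, rayVec_self_left hposet hpq]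
          · rw [rayVec_eq_of_ne hposet ((hs t).1 ht).1 hpq htp, sub_self]
        rw [e1, Finset.sum_ite_eq']
        split_ifs with hmem
        · rfl
        · have : (p, q) = (a, b) := by
            by_contra hne
            exact hmem ((hs _).2 ⟨hpq, hne⟩)
          rw [Prod.mk.injEq] at this
          rw [this.1, this.2, hxab, sub_self]
      refine ⟨y, hyV, x a - y a, ?_⟩
      funext i
      have := const_of_covers hposet (fun i => x i - y i)
        (fun c d hcd => by have := hyc c d hcd; linarith) i a
      simp only [Pi.add_apply, Pi.smul_apply, allOnes, smul_eq_mul, mul_one]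
      linarith
    · rintro x ⟨y, ⟨s, c, hsV, hc, rfl⟩, μ, rfl⟩
      have hmono : ∀ p q, CoversRel r p q → ∀ v ∈ s, v p ≤ v q := by
        intro p q hpq v hv
        obtain ⟨c', d', hcd, -, rfl⟩ := hsV hv
        by_cases hne : (c', d') = (p, q)
        · rw [Prod.mk.injEq] at hne
          obtain ⟨rfl, rfl⟩ := hne
          rw [rayVec_self_right, rayVec_self_left hposet hpq]
          exact zero_le_one
        · exact (rayVec_eq_of_ne hposet hcd hpq hne).le
      refine ⟨mem_sigmaCone_of_covers hposet _ ?_, ?_⟩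
      · intro p q hpq
        simp only [Pi.add_apply, Finset.sum_apply, Pi.smul_apply, allOnes, smul_eq_mul]
        have := Finset.sum_le_sum fun v hv =>
          mul_le_mul_of_nonneg_left (hmono p q hpq v hv) (hc v hv)
        linarith
      · simp only [Set.mem_ofPred_eq, Pi.add_apply, Finset.sum_apply, Pi.smul_apply, allOnes]
        congr 1
        refine Finset.sum_congr rfl fun v hv => ?_
        obtain ⟨c', d', hcd, hne, rfl⟩ := hsV hv
        rw [rayVec_eq_of_ne hposet hcd hab hne]
  · apply Set.Subset.antisymm
    · rintro x ⟨hx, hxab⟩ i j hij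
      have hxab : x a = x b := hxab
      induction hij with
      | refl => exact le_rfl
      | tail _ hjk ih =>
        refine ih.trans ?_
        rcases hjk with hh | ⟨rfl, rfl⟩
        · exact hx _ _ hh
        · exact hxab.ge
    · intro x hx
      exact ⟨fun i j hij => hx i j (Relation.ReflTransGen.single (Or.inl hij)),
        le_antisymm (hx a b (Relation.ReflTransGen.single (Or.inl hab.1)))
          (hx b a (Relation.ReflTransGen.single (Or.inr ⟨rfl, rfl⟩)))⟩
end

section
/- Let n ≥ 1 and let ⪯ be a preposet on Fin n. Then the lineality space of the cone σ_⪯ satisfies σ_⪯ ∩ (−σ_⪯) = ℝ·e if and only if ⪯ is connected. (In general, σ_⪯ ∩ (−σ_⪯) is the linear subspace of vectors that are constant on each connected component of the comparability graph of ⪯.) -/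
open Pointwise in
/-- For a preposet `⪯` on `Fin n`, the lineality space of `σ_⪯`
satisfies `σ_⪯ ∩ (−σ_⪯) = ℝ·e` if and only if `⪯` is connected. -/
theorem lineality_eq_line_iff_connected (n : ℕ) (hn : 1 ≤ n)
    (r : Fin n → Fin n → Prop)
    (hrefl : ∀ a, r a a) (htrans : ∀ a b c, r a b → r b c → r a c) :
    sigmaCone r ∩ (-sigmaCone r) = {x | ∃ μ : ℝ, x = μ • allOnes n} ↔
      (compGraph r).Connected := by
  have hmem : ∀ x : Fin n → ℝ, x ∈ sigmaCone r ∩ (-sigmaCone r) ↔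
      ∀ a b, r a b → x a = x b := by
    intro x
    simp only [Set.mem_inter_iff, Set.mem_neg, sigmaCone, Set.mem_ofPred_eq, Pi.neg_apply,
      neg_le_neg_iff]
    exact ⟨fun h a b hab => le_antisymm (h.1 a b hab) (h.2 a b hab),
      fun h => ⟨fun a b hab => (h a b hab).le, fun a b hab => (h a b hab).ge⟩⟩
  have hne : Nonempty (Fin n) := ⟨⟨0, hn⟩⟩
  constructor
  · intro h
    refine { preconnected := fun u v => ?_, nonempty := hne }
    have hx : indVec {w | (compGraph r).Reachable u w} ∈ sigmaCone r ∩ (-sigmaCone r) := by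
      rw [hmem]
      intro a b hab
      by_cases hne : a = b
      · rw [hne]
      have hadj : (compGraph r).Adj a b := ⟨hne, Or.inl hab⟩
      have hiff : (compGraph r).Reachable u a ↔ (compGraph r).Reachable u b :=
        ⟨fun h => h.trans hadj.reachable, fun h => h.trans hadj.symm.reachable⟩
      by_cases hb : (compGraph r).Reachable u b
      · simp [indVec, Set.indicator, hb, hiff.2 hb]
      · simp [indVec, Set.indicator, hb, mt hiff.1 hb]
    rw [h] at hx
    obtain ⟨μ, hμ⟩ := hx
    have hu := congrFun hμ u
    have hv := congrFun hμ v
    by_contra hcon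
    simp [indVec, allOnes, Set.indicator, hcon] at hu hv
    rw [← hu] at hv
    norm_num at hv
  · intro h
    ext x
    rw [hmem]
    constructor
    · intro hx
      have hw : ∀ u v, (compGraph r).Walk u v → x u = x v := by
        intro u v p
        induction p with
        | nil => rfl
        | cons hadj _ ih =>
          refine Eq.trans ?_ ih
          rcases hadj.2 with h1 | h1
          · exact hx _ _ h1
          · exact (hx _ _ h1).symm
      refine ⟨x ⟨0, hn⟩, ?_⟩
      ext v
      obtain ⟨p⟩ := h.preconnected v ⟨0, hn⟩
      simpa [allOnes] using hw _ _ p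
    · rintro ⟨μ, rfl⟩ a b _
      simp [allOnes]
end

section
/- Let n ≥ 1 and let ⪯ be a connected preposet on Fin n. Then the linear span of the cone σ_⪯ equals the subspace {x ∈ ℝ^n : x_i = x_j whenever i ∼ j}; consequently the dimension of σ_⪯ equals the number of equivalence classes of ∼. -/
/-- For a connected preposet `⪯` on `Fin n`, the linear span of `σ_⪯`
is the subspace `{x : x_i = x_j whenever i ∼ j}`, and hence the dimension of `σ_⪯`
equals the number of `∼`-equivalence classes. -/
theorem span_sigmaCone_of_connected (n : ℕ) (hn : 1 ≤ n)
    (r : Fin n → Fin n → Prop)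
    (hrefl : ∀ a, r a a) (htrans : ∀ a b c, r a b → r b c → r a c)
    (hconn : (compGraph r).Connected) :
    (Submodule.span ℝ (sigmaCone r) : Set (Fin n → ℝ)) =
      {x | ∀ i j, r i j → r j i → x i = x j} ∧
    Module.finrank ℝ (Submodule.span ℝ (sigmaCone r)) =
      Nat.card (Quotient (preSetoid r hrefl htrans)) := by
  classical
  have key : (Submodule.span ℝ (sigmaCone r) : Set (Fin n → ℝ)) =
      {x | ∀ i j, r i j → r j i → x i = x j} := by
    apply Set.Subset.antisymm
    · intro x hx
      refine Submodule.span_induction (p := fun x _ => ∀ i j, r i j → r j i → x i = x j)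
        ?_ ?_ ?_ ?_ hx
      · intro y hy i j hij hji
        exact le_antisymm (hy i j hij) (hy j i hji)
      · intro i j _ _
        rfl
      · intro y z _ _ hy hz i j hij hji
        simp only [Pi.add_apply, hy i j hij hji, hz i j hij hji]
      · intro c y _ hy i j hij hji
        simp only [Pi.smul_apply, hy i j hij hji]
    · intro x hx
      let h : Fin n → ℝ := fun i => ((Finset.univ.filter (fun c => r c i)).card : ℝ)
      have hle : ∀ a b, r a b → h a ≤ h b := by
        intro a b hab
        have : (Finset.univ.filter (fun c => r c a)).card
            ≤ (Finset.univ.filter (fun c => r c b)).card := by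
          apply Finset.card_le_card
          intro c hc
          simp only [Finset.mem_filter, Finset.mem_univ, true_and] at hc ⊢
          exact htrans _ _ _ hc hab
        simp only [h]
        exact_mod_cast this
      have hlt : ∀ a b, r a b → ¬ r b a → h a + 1 ≤ h b := by
        intro a b hab hba
        have : (Finset.univ.filter (fun c => r c a)).card
            < (Finset.univ.filter (fun c => r c b)).card := by
          apply Finset.card_lt_card
          refine Finset.ssubset_iff_of_subset ?_ |>.mpr ⟨b, ?_, ?_⟩
          · intro c hc
            simp only [Finset.mem_filter, Finset.mem_univ, true_and] at hc ⊢
            exact htrans _ _ _ hc hab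
          · simp [hrefl]
          · simp [hba]
        simp only [h]
        exact_mod_cast this
      let M : ℝ := 2 * ∑ i, |x i|
      have hb : ∀ i, |x i| ≤ ∑ i, |x i| := fun i =>
        Finset.single_le_sum (f := fun i => |x i|) (fun _ _ => abs_nonneg _) (Finset.mem_univ i)
      have h1 : h ∈ sigmaCone r := hle
      have h2 : x + M • h ∈ sigmaCone r := by
        intro a b hab
        simp only [Pi.add_apply, Pi.smul_apply, smul_eq_mul]
        by_cases hba : r b a
        · rw [hx a b hab hba, le_antisymm (hle a b hab) (hle b a hba)]
        · have h3 := hlt a b hab hba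
          have h4 : x a - x b ≤ M := by
            have := hb a
            have := hb b
            have := le_abs_self (x a)
            have := neg_abs_le (x b)
            simp only [M]
            linarith
          have h5 : 0 ≤ M := mul_nonneg (by norm_num) (Finset.sum_nonneg fun _ _ => abs_nonneg _)
          nlinarith [mul_le_mul_of_nonneg_left h3 h5]
      have h6 : x = (x + M • h) - M • h := by simp
      rw [h6]
      exact Submodule.sub_mem _ (Submodule.subset_span h2)
        (Submodule.smul_mem _ _ (Submodule.subset_span h1))
  refine ⟨key, ?_⟩
  let q : Fin n → Quotient (preSetoid r hrefl htrans) := Quotient.mk _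
  have hq : Function.Surjective q := Quotient.mk_surjective
  have hr : Submodule.span ℝ (sigmaCone r) = LinearMap.range (LinearMap.funLeft ℝ ℝ q) := by
    apply SetLike.coe_injective
    rw [key]
    ext x
    constructor
    · intro hx
      exact ⟨Quotient.lift x (fun i j hij => hx i j hij.1 hij.2), rfl⟩
    · rintro ⟨y, rfl⟩ i j hij hji
      have : q i = q j := Quotient.sound ⟨hij, hji⟩
      simp only [LinearMap.funLeft_apply, this]
  rw [hr, LinearMap.finrank_range_of_inj (LinearMap.funLeft_injective_of_surjective ℝ ℝ q hq),
    Module.finrank_fintype_fun_eq_card, Nat.card_eq_fintype_card]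
end

section
/- Let n ≥ 1, let ⪯ be a tree poset on Fin n, let b ∈ Fin n, and let a_1, …, a_k (k ≥ 1) be exactly the elements covered by b (so b has down-degree k in the Hasse diagram). Let B = ∩_{i=1}^k B(a_i, b), i.e., B is the vertex set of the connected component of b in the Hasse diagram after deleting all k edges {a_i, b}. Then Σ_{i=1}^k v_{a_i→b} = e_B + (k−1)·e in ℝ^n. In particular, for each i, v_{a_i→b} = e_{Fin n ∖ A_i} where A_i is the component of a_i after deleting these k edges, and the sets A_1, …, A_k, B partition Fin n. -/
/-- Let `⪯` be a tree poset on `Fin n`, `b` an element with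
down-degree `k ≥ 1`, with `a 0, …, a (k-1)` exactly the elements covered by `b`, and let
`B = ⋂ i, B(a i, b)`. Then `Σ_i v_{a i → b} = e_B + (k−1)·e`; moreover each
`v_{a i → b} = e_{(A i)ᶜ}` where `A i` is the component of `a i` after deleting the
`k` edges `{a i, b}`, and the sets `A 0, …, A (k-1), B` partition `Fin n`. -/
theorem sum_rayVecs_at_down_vertex (n : ℕ) (hn : 1 ≤ n)
    (r : Fin n → Fin n → Prop) (hposet : IsTreePoset r)
    (b : Fin n) (k : ℕ) (hk : 1 ≤ k)
    (a : Fin k → Fin n) (hainj : Function.Injective a)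
    (hcov : ∀ x, CoversRel r x b ↔ ∃ i, a i = x) :
    (∑ i : Fin k, rayVec r (a i) b) =
        indVec (⋂ i, compB r (a i) b) + ((k : ℝ) - 1) • allOnes n ∧
    (∀ i, compB r (a i) b = (compA r a b i)ᶜ) ∧
    (∀ i, rayVec r (a i) b = indVec ((compA r a b i)ᶜ)) ∧
    (∀ i j, i ≠ j → Disjoint (compA r a b i) (compA r a b j)) ∧
    (∀ i, Disjoint (compA r a b i) (⋂ j, compB r (a j) b)) ∧
    ((⋃ i, compA r a b i) ∪ (⋂ j, compB r (a j) b)) = Set.univ := by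
  obtain ⟨-, -, -, htree⟩ := hposet
  set G := hasseGraph r with hG
  set H := G.deleteEdges {e | ∃ j, e = s(a j, b)} with hH
  have hadj : ∀ i, G.Adj (a i) b := fun i => Or.inl ((hcov _).2 ⟨i, rfl⟩)
  have hle : ∀ i, H ≤ G.deleteEdges {s(a i, b)} := by
    intro i x y h
    rw [hH, SimpleGraph.deleteEdges_adj] at h
    rw [SimpleGraph.deleteEdges_adj]
    exact ⟨h.1, fun h' => h.2 ⟨i, h'⟩⟩
  have hbr : ∀ i, ¬ (G.deleteEdges {s(a i, b)}).Reachable (a i) b := by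
    intro i
    have := SimpleGraph.isAcyclic_iff_forall_adj_isBridge.1 htree.isAcyclic (hadj i)
    exact SimpleGraph.isBridge_iff.1 this
  have hcover : ∀ x, H.Reachable b x ∨ ∃ i, H.Reachable (a i) x := by
    intro x
    have hr : Relation.ReflTransGen G.Adj b x :=
      (SimpleGraph.reachable_iff_reflTransGen _ _).1 (htree.connected.preconnected b x)
    induction hr with
    | refl => exact Or.inl (SimpleGraph.Reachable.refl _)
    | @tail y z _ hyz ih =>
      by_cases hd : ∃ j, s(y, z) = s(a j, b)
      · obtain ⟨j, hj⟩ := hd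
        rcases Sym2.eq_iff.1 hj with ⟨-, h2⟩ | ⟨-, h2⟩
        · rw [h2]; exact Or.inl (SimpleGraph.Reachable.refl _)
        · rw [h2]; exact Or.inr ⟨j, SimpleGraph.Reachable.refl _⟩
      · have hA : H.Adj y z := by
          rw [hH, SimpleGraph.deleteEdges_adj]
          exact ⟨hyz, hd⟩
        rcases ih with h | ⟨i, h⟩
        · exact Or.inl (h.trans hA.reachable)
        · exact Or.inr ⟨i, h.trans hA.reachable⟩
  have h2 : ∀ i x, x ∈ compA r a b i → x ∉ compB r (a i) b := by
    intro i x hx hx'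
    exact hbr i ((SimpleGraph.Reachable.mono (hle i) hx).trans (SimpleGraph.Reachable.symm hx'))
  have h3 : ∀ i j x, j ≠ i → x ∈ compA r a b j → x ∈ compB r (a i) b := by
    intro i j x hji hx
    have hA : (G.deleteEdges {s(a i, b)}).Adj b (a j) := by
      rw [SimpleGraph.deleteEdges_adj]
      refine ⟨(hadj j).symm, fun h => ?_⟩
      rcases Sym2.eq_iff.1 h with ⟨h, -⟩ | ⟨-, h⟩
      · exact (hadj i).ne h.symm
      · exact hji (hainj h)
    exact hA.reachable.trans (SimpleGraph.Reachable.mono (hle i) hx)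
  have hB : ∀ i, compB r (a i) b = (compA r a b i)ᶜ := by
    intro i
    ext x
    refine ⟨fun h h' => h2 i x h' h, fun h => ?_⟩
    rcases hcover x with hx | ⟨j, hx⟩
    · exact SimpleGraph.Reachable.mono (hle i) hx
    · exact h3 i j x (fun e => h (e ▸ hx)) hx
  have hdis : ∀ i j, i ≠ j → Disjoint (compA r a b i) (compA r a b j) := by
    intro i j hij
    rw [Set.disjoint_left]
    intro x hx hx'
    exact h2 i x hx (h3 i j x hij.symm hx')
  refine ⟨?_, hB, fun i => by rw [rayVec, hB], hdis, ?_, ?_⟩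
  · classical
    ext x
    simp only [rayVec, indVec, allOnes, Finset.sum_apply, Pi.add_apply, Pi.smul_apply,
      smul_eq_mul, mul_one, hB, Set.indicator_apply, Set.mem_iInter, Set.mem_compl_iff]
    by_cases hx : ∃ i, x ∈ compA r a b i
    · obtain ⟨i, hi⟩ := hx
      have hone : ∀ j, (if x ∉ compA r a b j then (1 : ℝ) else 0) = 1 - if j = i then 1 else 0 := by
        intro j
        by_cases hj : j = i
        · subst hj; simp [hi]
        · have : x ∉ compA r a b j := fun h => Set.disjoint_left.1 (hdis j i hj) h hi
          simp [hj, this]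
      rw [if_neg (fun h => h i hi), Finset.sum_congr rfl (fun j _ => hone j)]
      simp
    · push Not at hx
      simp [hx]
  · intro i
    rw [Set.disjoint_left]
    intro x hx hx'
    exact h2 i x hx (Set.mem_iInter.1 hx' i)
  · ext x
    simp only [hB, Set.mem_union, Set.mem_iUnion, Set.mem_iInter, Set.mem_compl_iff, Set.mem_univ,
      iff_true]
    by_cases hx : ∃ i, x ∈ compA r a b i
    · exact Or.inl hx
    · exact Or.inr (fun i h => hx ⟨i, h⟩)
end

section
/- Let n ≥ 1, let ⪯ be a tree poset on Fin n, let b ∈ Fin n have down-degree k ≥ 2, with a_1, …, a_k exactly the elements covered by b, and let ⪯' be the tree poset that is the reflexive-transitive closure of E' = {covering pairs (i,j) of ⪯ with j ≠ b} ∪ {(a_1,b)} ∪ {(a_i,a_1) : 2 ≤ i ≤ k}. Let B = ∩_{i=1}^k B_⪯(a_i,b). Then σ_{⪯'} = cone({v^⪯_{i→j} : (i,j) a covering pair of ⪯ with (i,j) ≠ (a_1,b)} ∪ {e_B}) + ℝ·e, and σ_{⪯'} ⊆ σ_⪯. -/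
theorem coneOf_sum {n : ℕ} {ι : Type} (V : Set (Fin n → ℝ)) (T : Finset ι)
    (f : ι → Fin n → ℝ) (c : ι → ℝ) (hf : ∀ i ∈ T, f i ∈ V) (hc : ∀ i ∈ T, 0 ≤ c i) :
    ∑ i ∈ T, c i • f i ∈ coneOf V := by
  classical
  refine ⟨T.image f, fun v => ∑ i ∈ T with f i = v, c i, ?_, ?_, ?_⟩
  · intro v hv
    simp only [Finset.coe_image, Set.mem_image, Finset.mem_coe] at hv
    obtain ⟨i, hi, rfl⟩ := hv
    exact hf i hi
  · intro v _
    exact Finset.sum_nonneg fun i hi => hc i (Finset.mem_filter.1 hi).1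
  · rw [← Finset.sum_fiberwise_of_maps_to (g := f) (t := T.image f)
      (fun i hi => Finset.mem_image_of_mem f hi)]
    refine Finset.sum_congr rfl fun v _ => ?_
    rw [Finset.sum_smul]
    refine Finset.sum_congr rfl fun i hi => ?_
    rw [(Finset.mem_filter.1 hi).2]

theorem compB_iff {n : ℕ} {r : Fin n → Fin n → Prop} (h : IsTreePoset r) {p q i j : Fin n}
    (hpq : CoversRel r p q) (hij : CoversRel r i j) (hne : (p, q) ≠ (i, j)) :
    j ∈ compB r p q ↔ i ∈ compB r p q := by
  have hadj : ((hasseGraph r).deleteEdges {s(p, q)}).Adj i j := by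
    rw [SimpleGraph.deleteEdges_adj]
    refine ⟨Or.inl hij, ?_⟩
    simp only [Set.mem_singleton_iff, Sym2.eq_iff, not_or]
    refine ⟨fun h1 => hne (by rw [h1.1, h1.2]), ?_⟩
    rintro ⟨rfl, rfl⟩
    exact hpq.2.1 (h.2.2.1 _ _ hpq.1 hij.1)
  exact ⟨fun h1 => SimpleGraph.Reachable.trans h1 hadj.symm.reachable,
    fun h1 => SimpleGraph.Reachable.trans h1 hadj.reachable⟩

theorem mem_compB {n : ℕ} (r : Fin n → Fin n → Prop) (p q : Fin n) : q ∈ compB r p q :=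
  SimpleGraph.Reachable.refl _

theorem not_mem_compB {n : ℕ} {r : Fin n → Fin n → Prop} (h : IsTreePoset r) {p q : Fin n}
    (hpq : CoversRel r p q) : p ∉ compB r p q := by
  have hb := SimpleGraph.isAcyclic_iff_forall_adj_isBridge.1 h.2.2.2.isAcyclic
    (show (hasseGraph r).Adj p q from Or.inl hpq)
  rw [SimpleGraph.isBridge_iff] at hb
  intro h1
  exact hb (SimpleGraph.Reachable.symm h1)

theorem rayVec_diff {n : ℕ} {r : Fin n → Fin n → Prop} (h : IsTreePoset r) {p q i j : Fin n}
    (hpq : CoversRel r p q) (hij : CoversRel r i j) :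
    rayVec r p q j = rayVec r p q i + if (p, q) = (i, j) then 1 else 0 := by
  classical
  unfold rayVec indVec
  split_ifs with he
  · obtain ⟨rfl, rfl⟩ := Prod.mk.inj he
    simp [Set.indicator, mem_compB, not_mem_compB h hpq]
  · simp [Set.indicator, compB_iff h hpq hij he]

theorem eB_diff {n k : ℕ} {r : Fin n → Fin n → Prop} (h : IsTreePoset r) {b : Fin n}
    {a : Fin k → Fin n} (hcov : ∀ x, CoversRel r x b ↔ ∃ i, a i = x) {i j : Fin n}
    (hij : CoversRel r i j) :
    indVec (⋂ m, compB r (a m) b) j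
      = indVec (⋂ m, compB r (a m) b) i + if j = b then 1 else 0 := by
  classical
  unfold indVec
  split_ifs with he
  · subst he
    obtain ⟨m, rfl⟩ := (hcov i).1 hij
    have h1 : a m ∉ ⋂ m, compB r (a m) j := fun h2 =>
      not_mem_compB h hij (Set.mem_iInter.1 h2 m)
    have h2 : j ∈ ⋂ m, compB r (a m) j := Set.mem_iInter.2 fun m => mem_compB r _ _
    simp only [Set.indicator, h1, h2, if_true, if_false, zero_add]
  · have h1 : (j ∈ ⋂ m, compB r (a m) b) ↔ i ∈ ⋂ m, compB r (a m) b := by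
      simp only [Set.mem_iInter]
      refine forall_congr' fun m => compB_iff h ((hcov _).2 ⟨m, rfl⟩) hij ?_
      intro h2
      exact he (Prod.mk.inj h2).2.symm
    simp only [Set.indicator, h1, add_zero]

theorem mono_of_covers {n : ℕ} {r : Fin n → Fin n → Prop} (h : IsTreePoset r) {x : Fin n → ℝ}
    (hx : ∀ i j, CoversRel r i j → x i ≤ x j) : x ∈ sigmaCone r := by
  classical
  obtain ⟨hrefl, htrans, hanti, -⟩ := h
  suffices H : ∀ N : ℕ, ∀ p q, (Finset.univ.filter fun c => r p c ∧ r c q).card ≤ N →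
      r p q → x p ≤ x q from fun p q hpq => H _ p q le_rfl hpq
  intro N
  induction N with
  | zero =>
    intro p q hN hpq
    have : p ∈ Finset.univ.filter fun c => r p c ∧ r c q := by simp [hrefl, hpq]
    rw [Nat.le_zero, Finset.card_eq_zero] at hN
    simp [hN] at this
  | succ N ih =>
    intro p q hN hpq
    by_cases hne : p = q
    · rw [hne]
    by_cases hc : CoversRel r p q
    · exact hx _ _ hc
    have : ∃ c, r p c ∧ r c q ∧ c ≠ p ∧ c ≠ q := by
      by_contra hcon
      push Not at hcon
      exact hc ⟨hpq, hne, fun c h1 h2 => by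
        by_cases h3 : c = p
        · exact Or.inl h3
        · exact Or.inr (hcon c h1 h2 h3)⟩
    obtain ⟨c, h1, h2, h3, h4⟩ := this
    refine le_trans (ih p c ?_ h1) (ih c q ?_ h2)
    · refine Nat.le_of_lt_succ (lt_of_lt_of_le (Finset.card_lt_card ?_) hN)
      rw [Finset.ssubset_iff_of_subset]
      · exact ⟨q, by simp [hrefl, hpq], by
          simp only [Finset.mem_filter, not_and]
          exact fun _ _ h5 => h4 (hanti _ _ h2 h5)⟩
      · intro d hd
        simp only [Finset.mem_filter, Finset.mem_univ, true_and] at hd ⊢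
        exact ⟨hd.1, htrans _ _ _ hd.2 h2⟩
    · refine Nat.le_of_lt_succ (lt_of_lt_of_le (Finset.card_lt_card ?_) hN)
      rw [Finset.ssubset_iff_of_subset]
      · exact ⟨p, by simp [hrefl, hpq], by
          simp only [Finset.mem_filter, not_and]
          exact fun _ h5 _ => h3 (hanti _ _ h5 h1)⟩
      · intro d hd
        simp only [Finset.mem_filter, Finset.mem_univ, true_and] at hd ⊢
        exact ⟨htrans _ _ _ h1 hd.1, hd.2⟩

theorem mem_sigmaCone_rtg {n : ℕ} {E : Fin n → Fin n → Prop} {x : Fin n → ℝ} :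
    x ∈ sigmaCone (Relation.ReflTransGen E) ↔ ∀ i j, E i j → x i ≤ x j := by
  refine ⟨fun h i j hij => h i j (Relation.ReflTransGen.single hij), fun h i j hij => ?_⟩
  induction hij with
  | refl => exact le_rfl
  | tail _ h1 ih => exact ih.trans (h _ _ h1)

theorem const_of_covers_s8 {n : ℕ} {r : Fin n → Fin n → Prop} (h : IsTreePoset r) {z : Fin n → ℝ}
    (hz : ∀ i j, CoversRel r i j → z j = z i) (i j : Fin n) : z i = z j := by
  obtain ⟨w⟩ := h.2.2.2.connected.preconnected i j
  induction w with
  | nil => rfl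
  | cons hadj _ ih =>
    rw [← ih]
    rcases hadj with h1 | h1
    · exact (hz _ _ h1).symm
    · exact hz _ _ h1

/-- With `⪯'` the tree poset of the star-subdivision step
(reflexive-transitive closure of `E'`), and `B = ⋂ i, B_⪯(a i, b)`, the cone `σ_⪯'`
equals `cone({v^⪯_{i→j} : i ⋖ j, (i,j) ≠ (a i₀, b)} ∪ {e_B}) + ℝ·e`,
and `σ_⪯' ⊆ σ_⪯`. -/
theorem sigmaCone_newRel_eq (n : ℕ) (hn : 1 ≤ n)
    (r : Fin n → Fin n → Prop) (hposet : IsTreePoset r)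
    (b : Fin n) (k : ℕ) (hk : 2 ≤ k)
    (a : Fin k → Fin n) (hainj : Function.Injective a)
    (hcov : ∀ x, CoversRel r x b ↔ ∃ i, a i = x) (i₀ : Fin k) :
    sigmaCone (Relation.ReflTransGen (newRel r a b i₀)) =
      coneAddLine ({v | ∃ i j, CoversRel r i j ∧ (i, j) ≠ (a i₀, b) ∧ v = rayVec r i j} ∪
        {indVec (⋂ i, compB r (a i) b)}) ∧
    sigmaCone (Relation.ReflTransGen (newRel r a b i₀)) ⊆ sigmaCone r := by
  classical
  have hca : ∀ m, CoversRel r (a m) b := fun m => (hcov _).2 ⟨m, rfl⟩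
  refine ⟨Set.Subset.antisymm ?_ ?_, ?_⟩
  · intro x hx
    rw [mem_sigmaCone_rtg] at hx
    set eB := indVec (⋂ i, compB r (a i) b) with heB
    let T : Finset (Fin n × Fin n) := Finset.univ.filter fun p => CoversRel r p.1 p.2
    let f : Fin n × Fin n → Fin n → ℝ := fun p =>
      if p = (a i₀, b) then eB else rayVec r p.1 p.2
    let c : Fin n × Fin n → ℝ := fun p =>
      if p.2 = b then (if p.1 = a i₀ then x b - x (a i₀) else x (a i₀) - x p.1)
        else x p.2 - x p.1
    refine ⟨∑ p ∈ T, c p • f p, coneOf_sum _ T f c ?_ ?_, x ⟨0, hn⟩ -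
      (∑ p ∈ T, c p • f p) ⟨0, hn⟩, ?_⟩
    · rintro ⟨i, j⟩ hp
      have hij : CoversRel r i j := (Finset.mem_filter.1 hp).2
      by_cases h1 : (i, j) = (a i₀, b)
      · right
        simp [f, h1]
      · left
        exact ⟨i, j, hij, h1, by simp only [f, if_neg h1]⟩
    · rintro ⟨i, j⟩ hp
      have hij : CoversRel r i j := (Finset.mem_filter.1 hp).2
      simp only [c]
      split_ifs with h1 h2
      · exact sub_nonneg.2 (hx _ _ (Or.inr (Or.inl ⟨rfl, rfl⟩)))
      · subst h1
        obtain ⟨m, rfl⟩ := (hcov i).1 hij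
        exact sub_nonneg.2 (hx _ _ (Or.inr (Or.inr ⟨m, fun h3 => h2 (by rw [h3]), rfl, rfl⟩)))
      · exact sub_nonneg.2 (hx _ _ (Or.inl ⟨hij, h1⟩))
    · have key : ∀ i j, CoversRel r i j →
          (x - ∑ p ∈ T, c p • f p) j = (x - ∑ p ∈ T, c p • f p) i := by
        intro i j hij
        have hmem : (i, j) ∈ T := by simp [T, hij]
        have hmem0 : (a i₀, b) ∈ T := by simp [T, hca]
        have hs : ∑ p ∈ T, c p * f p j = ∑ p ∈ T, c p * f p i + (x j - x i) := by
          have h1 : ∀ p ∈ T, c p * f p j = c p * f p i +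
              ((if p = (i, j) then (if p = (a i₀, b) then 0 else c p) else 0) +
                (if p = (a i₀, b) then (if j = b then c p else 0) else 0)) := by
            rintro ⟨p, q⟩ hp
            have hpq : CoversRel r p q := (Finset.mem_filter.1 hp).2
            by_cases h2 : (p, q) = (a i₀, b)
            · simp only [f, if_pos h2, heB]
              rw [eB_diff hposet hcov hij]
              split_ifs <;> ring
            · simp only [f, if_neg h2]
              rw [rayVec_diff hposet hpq hij]
              split_ifs <;> ring
          rw [Finset.sum_congr rfl h1, Finset.sum_add_distrib, Finset.sum_add_distrib,
            Finset.sum_ite_eq' T (i, j), Finset.sum_ite_eq' T (a i₀, b), if_pos hmem, if_pos hmem0]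
          congr 1
          by_cases hj : j = b
          · subst hj
            by_cases hi : i = a i₀
            · subst hi
              simp [c]
            · simp [c, hi]
          · simp [c, hj]
        simp only [Pi.sub_apply, Finset.sum_apply, Pi.smul_apply, smul_eq_mul]
        rw [hs]
        ring
      ext j
      have h3 := const_of_covers_s8 hposet key j ⟨0, hn⟩
      simp only [Pi.sub_apply] at h3
      simp only [Pi.add_apply, Pi.smul_apply, allOnes, smul_eq_mul, mul_one]
      linarith
  · rintro x ⟨y, ⟨s, c, hs, hc, rfl⟩, μ, rfl⟩
    rw [mem_sigmaCone_rtg]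
    intro i j hE
    simp only [Pi.add_apply, Finset.sum_apply, Pi.smul_apply, allOnes, smul_eq_mul, mul_one]
    refine add_le_add (Finset.sum_le_sum fun v hv => mul_le_mul_of_nonneg_left ?_ (hc v hv)) le_rfl
    have hpos : ∀ P : Prop, [Decidable P] → (0 : ℝ) ≤ if P then 1 else 0 := by
      intro P _
      split_ifs <;> norm_num
    rcases hs hv with ⟨p, q, hpq, hne, rfl⟩ | hv
    · have hcovle : ∀ i j, CoversRel r i j → rayVec r p q i ≤ rayVec r p q j := by
        intro i j hij
        rw [rayVec_diff hposet hpq hij]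
        linarith [hpos ((p, q) = (i, j))]
      rcases hE with ⟨hij, -⟩ | ⟨rfl, rfl⟩ | ⟨m, hm, rfl, rfl⟩
      · exact hcovle _ _ hij
      · exact hcovle _ _ (hca _)
      · have h1 := rayVec_diff hposet hpq (hca i₀)
        rw [if_neg hne] at h1
        have h2 := hcovle _ _ (hca m)
        linarith
    · rw [Set.mem_singleton_iff] at hv
      subst hv
      rcases hE with ⟨hij, -⟩ | ⟨rfl, rfl⟩ | ⟨m, hm, rfl, rfl⟩
      · rw [eB_diff hposet hcov hij]
        linarith [hpos (j = b)]
      · rw [eB_diff hposet hcov (hca i₀)]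
        simp
      · have h1 := eB_diff hposet hcov (hca i₀)
        have h2 := eB_diff hposet hcov (hca m)
        linarith
  · intro x hx
    rw [mem_sigmaCone_rtg] at hx
    refine mono_of_covers hposet fun i j hij => ?_
    by_cases hj : j = b
    · subst hj
      obtain ⟨m, rfl⟩ := (hcov i).1 hij
      have h0 : x (a i₀) ≤ x j := hx _ _ (Or.inr (Or.inl ⟨rfl, rfl⟩))
      by_cases hm : m = i₀
      · rw [hm]
        exact h0
      · exact (hx _ _ (Or.inr (Or.inr ⟨m, hm, rfl, rfl⟩))).trans h0
    · exact hx _ _ (Or.inl ⟨hij, hj⟩)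
end

section
/- Let n ≥ 1, let ⪯ be a tree poset on Fin n, let b ∈ Fin n have down-degree k ≥ 2, with a_1, …, a_k exactly the elements covered by b, and let ⪯' be the tree poset that is the reflexive-transitive closure of E' = {covering pairs (i,j) of ⪯ with j ≠ b} ∪ {(a_1,b)} ∪ {(a_i,a_1) : 2 ≤ i ≤ k}. Then the ray generators match as follows: (i) for every covering pair (i,j) of ⪯ with j ≠ b, B_⪯(i,j) = B_{⪯'}(i,j), so v^⪯_{i→j} = v^{⪯'}_{i→j}; (ii) for 2 ≤ i ≤ k, B_⪯(a_i,b) = B_{⪯'}(a_i,a_1), so v^⪯_{a_i→b} = v^{⪯'}_{a_i→a_1}; and (iii) B_{⪯'}(a_1,b) = ∩_{i=1}^k B_⪯(a_i,b), so v^{⪯'}_{a_1→b} = e_B where B = ∩_{i=1}^k B_⪯(a_i,b). -/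
/-- `f` is a cut separating the single edge `u → v` in the relation `E`. -/
def IsCutFor {n : ℕ} (E : Fin n → Fin n → Prop) (u v : Fin n) (f : Set (Fin n)) : Prop :=
  v ∈ f ∧ u ∉ f ∧ ∀ p q, E p q → ¬ (p = u ∧ q = v) → (p ∈ f ↔ q ∈ f)

theorem IsCutFor.mono_step {n : ℕ} {E : Fin n → Fin n → Prop} {u v : Fin n} {f : Set (Fin n)}
    (h : IsCutFor E u v f) {p q : Fin n} (hpq : Relation.ReflTransGen E p q) (hp : p ∈ f) :
    q ∈ f := by
  induction hpq with
  | refl => exact hp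
  | @tail c d _ h2 ih =>
    by_cases hc : c = u ∧ d = v
    · rw [hc.2]; exact h.1
    · exact (h.2.2 _ _ h2 hc).1 ih

theorem coversRel_reflTransGen_iff {n : ℕ} {E : Fin n → Fin n → Prop}
    (hE : ∀ u v, E u v → ∃ f, IsCutFor E u v f) (x y : Fin n) :
    CoversRel (Relation.ReflTransGen E) x y ↔ E x y := by
  have hirr : ∀ u, ¬ E u u := by
    intro u hu
    obtain ⟨f, h1, h2, _⟩ := hE u u hu
    exact h2 h1
  have hback : ∀ u v, E u v → ¬ Relation.ReflTransGen E v u := by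
    intro u v huv hvu
    obtain ⟨f, hf⟩ := hE u v huv
    exact hf.2.1 (hf.mono_step hvu hf.1)
  constructor
  · rintro ⟨h1, h2, h3⟩
    rcases Relation.ReflTransGen.cases_head h1 with h | ⟨z, hxz, hzy⟩
    · exact absurd h h2
    · rcases h3 z (Relation.ReflTransGen.single hxz) hzy with h | h
      · subst h; exact absurd hxz (hirr _)
      · subst h; exact hxz
  · intro hxy
    refine ⟨Relation.ReflTransGen.single hxy, fun h => hirr x (by rw [← h] at hxy; exact hxy), ?_⟩
    intro c hxc hcy
    rcases Relation.ReflTransGen.cases_head hxc with h | ⟨z, hxz, hzc⟩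
    · exact Or.inl h.symm
    · right
      by_cases hzy : z = y
      · subst hzy
        rcases Relation.ReflTransGen.cases_head hzc with h | ⟨w, hzw, hwc⟩
        · exact h.symm
        · exact absurd (hwc.trans hcy) (hback _ _ hzw)
      · exfalso
        obtain ⟨f, hf⟩ := hE x z hxz
        have hy : y ∈ f := hf.mono_step (hzc.trans hcy) hf.1
        exact hf.2.1 ((hf.2.2 x y hxy (fun h => hzy h.2.symm)).2 hy)

theorem compB_eq_of_isCutFor {n : ℕ} {s E : Fin n → Fin n → Prop}
    (hs : ∀ x y, CoversRel s x y ↔ E x y) (hconn : ∀ x y, (hasseGraph s).Reachable x y)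
    {u v : Fin n} {f : Set (Fin n)} (hf : IsCutFor E u v f) : compB s u v = f := by
  have hinv : ∀ p q, ((hasseGraph s).deleteEdges {s(u, v)}).Reachable p q → (p ∈ f ↔ q ∈ f) := by
    intro p q h
    rw [SimpleGraph.reachable_iff_reflTransGen] at h
    induction h with
    | refl => rfl
    | @tail c d _ h2 ih =>
      rw [ih]
      rw [SimpleGraph.deleteEdges_adj] at h2
      obtain ⟨h2, h3⟩ := h2
      simp only [Set.mem_singleton_iff, Sym2.eq_iff, not_or] at h3
      rcases h2 with h2 | h2
      · exact hf.2.2 _ _ ((hs _ _).1 h2) h3.1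
      · exact (hf.2.2 _ _ ((hs _ _).1 h2) (fun h => h3.2 ⟨h.2, h.1⟩)).symm
  have hcover : ∀ x, ((hasseGraph s).deleteEdges {s(u, v)}).Reachable v x ∨
      ((hasseGraph s).deleteEdges {s(u, v)}).Reachable u x := by
    intro x
    have h := hconn v x
    rw [SimpleGraph.reachable_iff_reflTransGen] at h
    induction h with
    | refl => exact Or.inl (SimpleGraph.Reachable.refl _)
    | @tail c d _ h2 ih =>
      by_cases hc : s(c, d) = s(u, v)
      · rcases Sym2.eq_iff.1 hc with h | h
        · rw [h.2]; exact Or.inl (SimpleGraph.Reachable.refl _)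
        · rw [h.2]; exact Or.inr (SimpleGraph.Reachable.refl _)
      · have h3 : ((hasseGraph s).deleteEdges {s(u, v)}).Adj c d := by
          rw [SimpleGraph.deleteEdges_adj]; exact ⟨h2, hc⟩
        exact ih.imp (fun h => h.trans h3.reachable) (fun h => h.trans h3.reachable)
  ext x
  constructor
  · intro hx
    exact (hinv _ _ hx).1 hf.1
  · intro hx
    rcases hcover x with h | h
    · exact h
    · exact absurd ((hinv _ _ h).2 hx) hf.2.1

theorem isCutFor_compB {n : ℕ} {r : Fin n → Fin n → Prop} (hr : IsTreePoset r) {u v : Fin n}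
    (huv : CoversRel r u v) : IsCutFor (CoversRel r) u v (compB r u v) := by
  obtain ⟨_, _, hanti, htree⟩ := hr
  refine ⟨SimpleGraph.Reachable.refl _, ?_, ?_⟩
  · intro h
    exact SimpleGraph.isBridge_iff.1
      (SimpleGraph.isAcyclic_iff_forall_adj_isBridge.1 htree.isAcyclic (Or.inl huv))
      (SimpleGraph.Reachable.symm h)
  · intro p q hpq hne
    have hadj : ((hasseGraph r).deleteEdges {s(u, v)}).Adj p q := by
      rw [SimpleGraph.deleteEdges_adj]
      refine ⟨Or.inl hpq, ?_⟩
      intro h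
      rcases Sym2.eq_iff.1 h with h | h
      · exact hne h
      · rw [h.1, h.2] at hpq
        exact huv.2.1 (hanti _ _ huv.1 hpq.1)
    exact ⟨fun h => SimpleGraph.Reachable.trans h hadj.reachable,
      fun h => SimpleGraph.Reachable.trans h hadj.symm.reachable⟩

/-- With `⪯'` the tree poset of the star-subdivision step, the ray
generators match: (i) for covering pairs `(i,j)` of `⪯` with `j ≠ b`,
`B_⪯(i,j) = B_⪯'(i,j)`; (ii) for `m ≠ i₀`, `B_⪯(a m, b) = B_⪯'(a m, a i₀)`;
(iii) `B_⪯'(a i₀, b) = ⋂ i, B_⪯(a i, b)`, with the corresponding equalities of the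
vectors `v`. -/
theorem rayVecs_of_newRel_match (n : ℕ) (hn : 1 ≤ n)
    (r : Fin n → Fin n → Prop) (hposet : IsTreePoset r)
    (b : Fin n) (k : ℕ) (hk : 2 ≤ k)
    (a : Fin k → Fin n) (hainj : Function.Injective a)
    (hcov : ∀ x, CoversRel r x b ↔ ∃ i, a i = x) (i₀ : Fin k) :
    (∀ i j, CoversRel r i j → j ≠ b →
      compB r i j = compB (Relation.ReflTransGen (newRel r a b i₀)) i j ∧
      rayVec r i j = rayVec (Relation.ReflTransGen (newRel r a b i₀)) i j) ∧
    (∀ m, m ≠ i₀ →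
      compB r (a m) b = compB (Relation.ReflTransGen (newRel r a b i₀)) (a m) (a i₀) ∧
      rayVec r (a m) b = rayVec (Relation.ReflTransGen (newRel r a b i₀)) (a m) (a i₀)) ∧
    (compB (Relation.ReflTransGen (newRel r a b i₀)) (a i₀) b = ⋂ i, compB r (a i) b ∧
      rayVec (Relation.ReflTransGen (newRel r a b i₀)) (a i₀) b =
        indVec (⋂ i, compB r (a i) b)) := by
  have hab : ∀ m, CoversRel r (a m) b := fun m => (hcov _).2 ⟨m, rfl⟩
  -- the three kinds of cuts
  have cut1 : ∀ i j, CoversRel r i j → j ≠ b →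
      IsCutFor (newRel r a b i₀) i j (compB r i j) := by
    intro i j hij hjb
    have hc := isCutFor_compB hposet hij
    have hb : ∀ m, (a m ∈ compB r i j ↔ b ∈ compB r i j) :=
      fun m => hc.2.2 _ _ (hab m) (fun h => hjb h.2.symm)
    refine ⟨hc.1, hc.2.1, ?_⟩
    rintro p q (⟨h, _⟩ | ⟨rfl, rfl⟩ | ⟨m, _, rfl, rfl⟩) hne
    · exact hc.2.2 _ _ h hne
    · exact hb _
    · rw [hb, hb]
  have cut2 : ∀ m, m ≠ i₀ → IsCutFor (newRel r a b i₀) (a m) (a i₀) (compB r (a m) b) := by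
    intro m hm
    have hc := isCutFor_compB hposet (hab m)
    have hb : ∀ m', m' ≠ m → a m' ∈ compB r (a m) b :=
      fun m' h' => (hc.2.2 _ _ (hab m') (fun h => h' (hainj h.1))).2 hc.1
    refine ⟨hb _ hm.symm, hc.2.1, ?_⟩
    rintro p q (⟨h, hq⟩ | ⟨rfl, rfl⟩ | ⟨m', _, rfl, rfl⟩) hne
    · exact hc.2.2 _ _ h (fun h => hq h.2)
    · exact iff_of_true (hb _ hm.symm) hc.1
    · exact iff_of_true (hb _ (fun h => hne ⟨by rw [h], rfl⟩)) (hb _ hm.symm)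
  have cut3 : IsCutFor (newRel r a b i₀) (a i₀) b (⋂ i, compB r (a i) b) := by
    have hc := fun m => isCutFor_compB hposet (hab m)
    have hn : ∀ m, a m ∉ ⋂ i, compB r (a i) b :=
      fun m h => (hc m).2.1 (Set.mem_iInter.1 h m)
    refine ⟨Set.mem_iInter.2 fun m => (hc m).1, hn _, ?_⟩
    rintro p q (⟨h, hq⟩ | ⟨rfl, rfl⟩ | ⟨m', _, rfl, rfl⟩) hne
    · simp only [Set.mem_iInter]
      exact forall_congr' fun m => (hc m).2.2 _ _ h (fun h => hq h.2)
    · exact absurd ⟨rfl, rfl⟩ hne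
    · exact iff_of_false (hn _) (hn _)
  have hs := coversRel_reflTransGen_iff (E := newRel r a b i₀) (by
    rintro u v (⟨h, hq⟩ | ⟨rfl, rfl⟩ | ⟨m, hm, rfl, rfl⟩)
    · exact ⟨_, cut1 _ _ h hq⟩
    · exact ⟨_, cut3⟩
    · exact ⟨_, cut2 m hm⟩)
  have hstep : ∀ p q, newRel r a b i₀ p q →
      (hasseGraph (Relation.ReflTransGen (newRel r a b i₀))).Reachable p q :=
    fun p q h => SimpleGraph.Adj.reachable (Or.inl ((hs _ _).2 h))
  have hcr : ∀ p q, CoversRel r p q →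
      (hasseGraph (Relation.ReflTransGen (newRel r a b i₀))).Reachable p q := by
    intro p q h
    by_cases hq : q = b
    · subst hq
      obtain ⟨m, rfl⟩ := (hcov p).1 h
      have h0 := hstep (a i₀) q (Or.inr (Or.inl ⟨rfl, rfl⟩))
      by_cases hm : m = i₀
      · rw [hm]; exact h0
      · exact (hstep (a m) (a i₀) (Or.inr (Or.inr ⟨m, hm, rfl, rfl⟩))).trans h0
    · exact hstep _ _ (Or.inl ⟨h, hq⟩)
  have hconn : ∀ x y, (hasseGraph (Relation.ReflTransGen (newRel r a b i₀))).Reachable x y := by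
    intro x y
    have h := hposet.2.2.2.connected.preconnected x y
    rw [SimpleGraph.reachable_iff_reflTransGen] at h
    induction h with
    | refl => exact SimpleGraph.Reachable.refl _
    | tail _ h2 ih =>
      rcases h2 with h2 | h2
      · exact ih.trans (hcr _ _ h2)
      · exact ih.trans (hcr _ _ h2).symm
  refine ⟨fun i j hij hj => ?_, fun m hm => ?_, ?_⟩
  · have h := compB_eq_of_isCutFor hs hconn (cut1 i j hij hj)
    exact ⟨h.symm, by rw [rayVec, rayVec, h]⟩
  · have h := compB_eq_of_isCutFor hs hconn (cut2 m hm)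
    exact ⟨h.symm, by rw [rayVec, rayVec, h]⟩
  · have h := compB_eq_of_isCutFor hs hconn cut3
    exact ⟨h, by rw [rayVec, h]⟩
end

section
/- Let n ≥ 1, let ⪯ be a tree poset on Fin n, let b ∈ Fin n have down-degree k ≥ 2, with a_1, …, a_k exactly the elements covered by b, and let B = ∩_{i=1}^k B_⪯(a_i,b). For each 1 ≤ m ≤ k let C_m = cone(({v^⪯_{i→j} : (i,j) a covering pair of ⪯} ∖ {v^⪯_{a_m→b}}) ∪ {e_B}) + ℝ·e. Then σ_⪯ = ∪_{m=1}^k C_m; that is, the cones obtained by replacing one of the generators v^⪯_{a_m→b} of σ_⪯ with the new vector e_B cover σ_⪯. -/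
theorem aux_ray_diff {n : ℕ} {r : Fin n → Fin n → Prop} (h : IsTreePoset r) {i j p q : Fin n}
    (hij : CoversRel r i j) (hpq : CoversRel r p q) :
    (¬ (i = p ∧ j = q) → (p ∈ compB r i j ↔ q ∈ compB r i j)) ∧
      (j ∈ compB r i j ∧ i ∉ compB r i j) := by
  obtain ⟨hrefl, htrans, hanti, htree⟩ := h
  refine ⟨fun hne => ?_, SimpleGraph.Reachable.refl _, ?_⟩
  · have hadj : ((hasseGraph r).deleteEdges {s(i, j)}).Adj p q := by
      rw [SimpleGraph.deleteEdges_adj]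
      refine ⟨Or.inl hpq, ?_⟩
      rw [Set.mem_singleton_iff, Sym2.eq_iff]
      rintro (⟨h1, h2⟩ | ⟨h1, h2⟩)
      · exact hne ⟨h1.symm, h2.symm⟩
      · subst h1 h2
        exact hij.2.1 (hanti _ _ hij.1 hpq.1)
    exact ⟨fun hp => SimpleGraph.Reachable.trans hp hadj.reachable,
      fun hq => SimpleGraph.Reachable.trans hq hadj.symm.reachable⟩
  · intro hi
    have hb := SimpleGraph.isAcyclic_iff_forall_edge_isBridge.1 htree.isAcyclic
      (e := s(i, j)) (by rw [SimpleGraph.mem_edgeSet]; exact Or.inl hij)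
    rw [SimpleGraph.isBridge_iff] at hb
    exact hb (SimpleGraph.Reachable.symm hi)

open Classical in
theorem aux_ray_sub {n : ℕ} {r : Fin n → Fin n → Prop} (h : IsTreePoset r) {i j p q : Fin n}
    (hij : CoversRel r i j) (hpq : CoversRel r p q) :
    rayVec r i j q - rayVec r i j p = if (i, j) = (p, q) then 1 else 0 := by
  have hd := aux_ray_diff h hij hpq
  by_cases he : i = p ∧ j = q
  · obtain ⟨rfl, rfl⟩ := he
    simp [rayVec, indVec, hd.2.1, hd.2.2]
  · have := hd.1 he
    rw [if_neg (by simpa using he)]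
    simp only [rayVec, indVec, Set.indicator_apply, this, sub_self]

open Classical in
theorem aux_B_sub {n : ℕ} {r : Fin n → Fin n → Prop} (h : IsTreePoset r) {b : Fin n} {k : ℕ}
    {a : Fin k → Fin n} (hcov : ∀ x, CoversRel r x b ↔ ∃ i, a i = x) {p q : Fin n}
    (hpq : CoversRel r p q) :
    indVec (⋂ i, compB r (a i) b) q - indVec (⋂ i, compB r (a i) b) p
      = if q = b then 1 else 0 := by
  have hc : ∀ i, CoversRel r (a i) b := fun i => (hcov _).2 ⟨i, rfl⟩
  by_cases he : q = b
  · subst he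
    obtain ⟨i, rfl⟩ := (hcov p).1 hpq
    have h1 : q ∈ ⋂ i, compB r (a i) q := Set.mem_iInter.2 fun i => (aux_ray_diff h (hc i) (hc i)).2.1
    have h2 : a i ∉ ⋂ i, compB r (a i) q := fun hm =>
      (aux_ray_diff h (hc i) (hc i)).2.2 (Set.mem_iInter.1 hm i)
    simp only [indVec, Set.indicator_apply, h1, h2, if_true, if_false, sub_zero]
  · have : p ∈ (⋂ i, compB r (a i) b) ↔ q ∈ (⋂ i, compB r (a i) b) := by
      rw [Set.mem_iInter, Set.mem_iInter]
      exact forall_congr' fun i => (aux_ray_diff h (hc i) hpq).1 fun hh => he hh.2.symm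
    simp only [indVec, Set.indicator_apply, this, sub_self, he, if_false]

theorem aux_const {n : ℕ} {r : Fin n → Fin n → Prop} (h : IsTreePoset r) (w : Fin n → ℝ)
    (hw : ∀ p q, CoversRel r p q → w p = w q) (x y : Fin n) : w x = w y := by
  obtain ⟨W⟩ := h.2.2.2.connected.preconnected x y
  induction W with
  | nil => rfl
  | cons hadj _ ih =>
    rw [← ih]
    rcases hadj with h1 | h1
    · exact hw _ _ h1
    · exact (hw _ _ h1).symm

theorem aux_sigma {n : ℕ} {r : Fin n → Fin n → Prop} (h : IsTreePoset r) (x : Fin n → ℝ)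
    (hx : ∀ p q, CoversRel r p q → x p ≤ x q) : x ∈ sigmaCone r := by
  classical
  obtain ⟨hrefl, htrans, hanti, -⟩ := h
  intro p q hpq
  -- induction on the size of the interval
  induction hN : (Finset.univ.filter fun c => r p c ∧ r c q).card using Nat.strong_induction_on
    generalizing p q with
  | _ N ih =>
    subst hN
    by_cases hne : p = q
    · rw [hne]
    by_cases hc : CoversRel r p q
    · exact hx _ _ hc
    · have : ∃ c, r p c ∧ r c q ∧ c ≠ p ∧ c ≠ q := by
        by_contra hcon
        push Not at hcon
        refine hc ⟨hpq, hne, fun c h1 h2 => ?_⟩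
        by_cases h3 : c = p
        · exact Or.inl h3
        · exact Or.inr (hcon c h1 h2 h3)
      obtain ⟨c, h1, h2, h3, h4⟩ := this
      refine (ih _ (Finset.card_lt_card ?_) p c h1 rfl).trans
        (ih _ (Finset.card_lt_card ?_) c q h2 rfl)
      · refine Finset.ssubset_iff_of_subset (fun z hz => ?_) |>.2 ⟨q, ?_, ?_⟩
        · simp only [Finset.mem_filter, Finset.mem_univ, true_and] at hz ⊢
          exact ⟨hz.1, htrans _ _ _ hz.2 h2⟩
        · simpa using ⟨hpq, hrefl q⟩
        · simp only [Finset.mem_filter, Finset.mem_univ, true_and]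
          exact fun hh => h4 (hanti _ _ h2 hh.2)
      · refine Finset.ssubset_iff_of_subset (fun z hz => ?_) |>.2 ⟨p, ?_, ?_⟩
        · simp only [Finset.mem_filter, Finset.mem_univ, true_and] at hz ⊢
          exact ⟨htrans _ _ _ h1 hz.1, hz.2⟩
        · simpa using ⟨hrefl p, hpq⟩
        · simp only [Finset.mem_filter, Finset.mem_univ, true_and]
          exact fun hh => h3 (hanti _ _ hh.1 h1)

theorem aux_cone {n : ℕ} {ι : Type*} (V : Set (Fin n → ℝ)) (t : Finset ι)
    (f : ι → Fin n → ℝ) (d : ι → ℝ) (hd : ∀ i ∈ t, 0 ≤ d i) (hf : ∀ i ∈ t, d i ≠ 0 → f i ∈ V) :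
    ∑ i ∈ t, d i • f i ∈ coneOf V := by
  classical
  let t' := t.filter fun i => d i ≠ 0
  refine ⟨t'.image f, fun v => ∑ i ∈ t' with f i = v, d i, ?_, ?_, ?_⟩
  · intro v hv
    obtain ⟨i, hi, rfl⟩ := Finset.mem_image.1 (Finset.mem_coe.1 hv)
    exact hf i (Finset.mem_filter.1 hi).1 (Finset.mem_filter.1 hi).2
  · intro v _
    exact Finset.sum_nonneg fun i hi =>
      hd i (Finset.mem_filter.1 (Finset.mem_filter.1 hi).1).1
  · have h1 : ∑ i ∈ t, d i • f i = ∑ i ∈ t', d i • f i := by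
      symm
      apply Finset.sum_filter_of_ne
      intro i _ h0 h2
      exact h0 (by rw [h2, zero_smul])
    rw [h1, ← Finset.sum_fiberwise_of_maps_to (t := t'.image f) (g := f)
      (fun i hi => Finset.mem_image_of_mem f hi)]
    refine Finset.sum_congr rfl fun v _ => ?_
    rw [Finset.sum_smul]
    refine Finset.sum_congr rfl fun i hi => ?_
    rw [(Finset.mem_filter.1 hi).2]

/-- Let `⪯` be a tree poset on `Fin n`, `b` of down-degree `k ≥ 2`
covering exactly `a 0, …, a (k-1)`, and `B = ⋂ i, B_⪯(a i, b)`. For each `m`, let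
`C_m = cone(({v^⪯_{i→j} : i ⋖ j} ∖ {v^⪯_{a m → b}}) ∪ {e_B}) + ℝ·e`. Then
`σ_⪯ = ⋃ m, C_m`. -/
theorem sigmaCone_eq_union_subdivided (n : ℕ) (hn : 1 ≤ n)
    (r : Fin n → Fin n → Prop) (hposet : IsTreePoset r)
    (b : Fin n) (k : ℕ) (hk : 2 ≤ k)
    (a : Fin k → Fin n) (hainj : Function.Injective a)
    (hcov : ∀ x, CoversRel r x b ↔ ∃ i, a i = x) :
    sigmaCone r = ⋃ m : Fin k,
      coneAddLine (({v | ∃ i j, CoversRel r i j ∧ v = rayVec r i j} \ {rayVec r (a m) b}) ∪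
        {indVec (⋂ i, compB r (a i) b)}) := by
  classical
  have hc : ∀ i, CoversRel r (a i) b := fun i => (hcov _).2 ⟨i, rfl⟩
  ext x
  rw [Set.mem_iUnion]
  constructor
  · intro hx
    have : Nonempty (Fin k) := ⟨⟨0, by omega⟩⟩
    obtain ⟨m, hm⟩ := Finite.exists_min fun i : Fin k => x b - x (a i)
    refine ⟨m, ?_⟩
    set cm : ℝ := x b - x (a m) with hcm
    have hcm0 : 0 ≤ cm := sub_nonneg.2 (hx _ _ (hc m).1)
    set eB := indVec (⋂ i, compB r (a i) b) with heB
    set T : Finset (Fin n × Fin n) := Finset.univ.filter fun p => CoversRel r p.1 p.2 with hT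
    let d : Fin n × Fin n → ℝ := fun p => x p.2 - x p.1 - if p.2 = b then cm else 0
    let y : Fin n → ℝ := cm • eB + ∑ p ∈ T, d p • rayVec r p.1 p.2
    have hy : y ∈ coneOf (({v | ∃ i j, CoversRel r i j ∧ v = rayVec r i j} \
        {rayVec r (a m) b}) ∪ {eB}) := by
      have := aux_cone (({v | ∃ i j, CoversRel r i j ∧ v = rayVec r i j} \
        {rayVec r (a m) b}) ∪ {eB}) (Finset.insertNone T)
        (fun o => o.elim eB fun p => rayVec r p.1 p.2) (fun o => o.elim cm d) ?_ ?_
      · rw [Finset.sum_insertNone] at this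
        exact this
      · rintro (_ | ⟨p, q⟩) ho
        · exact hcm0
        · have hpq : CoversRel r p q := by simpa [hT] using ho
          change 0 ≤ x q - x p - if q = b then cm else 0
          split_ifs with hqb
          · subst hqb
            obtain ⟨i, rfl⟩ := (hcov p).1 hpq
            exact sub_nonneg.2 (hm i)
          · rw [sub_zero]
            exact sub_nonneg.2 (hx _ _ hpq.1)
      · rintro (_ | ⟨p, q⟩) ho hne
        · exact Or.inr rfl
        · have hpq : CoversRel r p q := by simpa [hT] using ho
          refine Or.inl ⟨⟨p, q, hpq, rfl⟩, ?_⟩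
          intro heq
          have heq' : rayVec r p q = rayVec r (a m) b := heq
          have e1 := aux_ray_sub hposet hpq (hc m)
          have e2 := aux_ray_sub hposet (hc m) (hc m)
          rw [heq', e2, if_pos rfl] at e1
          by_cases h3 : (p, q) = (a m, b)
          · obtain ⟨rfl, rfl⟩ := Prod.mk.inj h3
            apply hne
            change x q - x (a m) - (if q = q then cm else 0) = 0
            rw [if_pos rfl, hcm, sub_self]
          · rw [if_neg h3] at e1
            exact one_ne_zero e1
    have hw : ∀ p q, CoversRel r p q → (x - y) p = (x - y) q := by
      intro p q hpq
      have hsum : (∑ e ∈ T, d e • rayVec r e.1 e.2) q - (∑ e ∈ T, d e • rayVec r e.1 e.2) p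
          = d (p, q) := by
        rw [Finset.sum_apply, Finset.sum_apply, ← Finset.sum_sub_distrib]
        have : ∀ e ∈ T, (d e • rayVec r e.1 e.2) q - (d e • rayVec r e.1 e.2) p
            = if e = (p, q) then d e else 0 := by
          rintro ⟨i, j⟩ he
          have hij : CoversRel r i j := by simpa [hT] using he
          have := aux_ray_sub hposet hij hpq
          simp only [Pi.smul_apply, smul_eq_mul, ← mul_sub]
          rw [this]
          split_ifs <;> simp
        rw [Finset.sum_congr rfl this, Finset.sum_ite_eq' T (p, q), if_pos]
        simpa [hT] using hpq
      have hBd := aux_B_sub hposet hcov hpq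
      rw [← heB] at hBd
      have hdpq : d (p, q) = x q - x p - if q = b then cm else 0 := rfl
      have hmul : cm * eB q - cm * eB p = if q = b then cm else 0 := by
        rw [← mul_sub, hBd]; split_ifs <;> simp
      simp only [y, Pi.sub_apply, Pi.add_apply, Pi.smul_apply, smul_eq_mul]
      linarith
    refine ⟨y, hy, (x - y) b, ?_⟩
    funext z
    have := aux_const hposet (x - y) hw z b
    simp only [Pi.add_apply, Pi.smul_apply, smul_eq_mul, allOnes, mul_one]
    rw [← this, Pi.sub_apply]
    ring
  · rintro ⟨m, y, ⟨s, c, hs, hc0, rfl⟩, μ, rfl⟩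
    apply aux_sigma hposet
    intro p q hpq
    simp only [Pi.add_apply, Finset.sum_apply, Pi.smul_apply, smul_eq_mul, allOnes]
    refine add_le_add_left (Finset.sum_le_sum fun v hv => mul_le_mul_of_nonneg_left ?_ (hc0 v hv)) _
    rw [← sub_nonneg]
    rcases hs hv with ⟨⟨i, j, hij, rfl⟩, -⟩ | h2
    · rw [aux_ray_sub hposet hij hpq]
      split_ifs <;> norm_num
    · rw [Set.mem_singleton_iff.1 h2, aux_B_sub hposet hcov hpq]
      split_ifs <;> norm_num
end
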